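/- Let ā₁,…,ā_n ∈ ℝ² be n > 2 vectors with ‖ā_i‖₂ ≤ 1 for all i, let σ > 0, and let a₁,…,a_n be independent with a_i ∼ N(ā_i, σ²I₂). Then there is a universal constant C > 0 such that the expected number of edges of the convex polygon conv(a₁,…,a_n) satisfies E[edges(conv(a₁,…,a_n))] ≤ C·((log n)^{1/4}/√σ + √(log n)). -/

import Mathlib

open MeasureTheory Set
open scoped ENNReal ProbabilityTheory Pointwise RealInnerProductSpace

noncomputable section

abbrev Euc (d : ℕ) := EuclideanSpace ℝ (Fin d)

/-- Number of edges (one-dimensional exposed faces) of a set. -/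
def edgeCount {d : ℕ} (S : Set (Euc d)) : ℕ :=
  Set.ncard {F : Set (Euc d) | IsExposed ℝ S F ∧ Module.finrank ℝ (vectorSpan ℝ F) = 1}

/-- Density of the `d`-dimensional Gaussian with mean `m` and covariance `σ² I`. -/
def gaussPdf (d : ℕ) (m : Euc d) (σ : ℝ) (x : Euc d) : ℝ :=
  (Real.sqrt (2 * Real.pi * σ ^ 2))⁻¹ ^ d * Real.exp (-‖x - m‖ ^ 2 / (2 * σ ^ 2))

/-- Joint law of `n` independent points in `ℝ^d`, the `i`-th having density `f i`. -/
def productDensityMeasure {n d : ℕ} (f : Fin n → Euc d → ℝ) :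
    Measure (Fin n → Euc d) :=
  volume.withDensity fun ω => ENNReal.ofReal (∏ i, f i (ω i))

/-- Joint law of `n` independent Gaussian points `a_i ∼ N(m i, σ² I_d)`. -/
def jointGaussian (n d : ℕ) (m : Fin n → Euc d) (σ : ℝ) : Measure (Fin n → Euc d) :=
  productDensityMeasure fun i => gaussPdf d (m i) σ


/-- The sign `1` or `-1` encoded by a Boolean. -/
def boolSign (b : Bool) : ℝ := if b then 1 else -1

/-- The linear form on the plane with coefficients `(± (1 - t), ± t)`; for `t ∈ [0, 1]` these are,
up to positive scaling, all linear forms whose coefficients have the signs prescribed by `e`. -/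
def quadrantForm (e : Bool × Bool) (t : ℝ) (x : Euc 2) : ℝ :=
  (1 - t) * (boolSign e.1 * x 0) + t * (boolSign e.2 * x 1)

/-- The difference of the two signed coordinates of a point. -/
def signedDiff (e : Bool × Bool) (x : Euc 2) : ℝ := boolSign e.2 * x 1 - boolSign e.1 * x 0

/-- The configurations in which some form of the quadrant `e` separates the `i`-th point from all
the others with a margin `δ`. -/
def gapEvent {n : ℕ} (e : Bool × Bool) (δ : ℝ) (i : Fin n) : Set (Fin n → Euc 2) :=
  {ω | ∃ t ∈ Icc (0 : ℝ) 1, ∀ j, j ≠ i → quadrantForm e t (ω j) + δ ≤ quadrantForm e t (ω i)}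

theorem boolSign_mul_self (b : Bool) : boolSign b * boolSign b = 1 := by
  cases b <;> norm_num [boolSign]

theorem abs_boolSign (b : Bool) : |boolSign b| = 1 := by
  cases b <;> norm_num [boolSign]

theorem continuous_quadrantForm (e : Bool × Bool) :
    Continuous fun p : ℝ × Euc 2 => quadrantForm e p.1 p.2 := by
  unfold quadrantForm
  fun_prop

theorem quadrantForm_eq (e : Bool × Bool) (s t : ℝ) (x : Euc 2) :
    quadrantForm e t x = quadrantForm e s x + (t - s) * signedDiff e x := by
  unfold quadrantForm signedDiff
  ring

theorem eq_of_quadrantForm_eq {e : Bool × Bool} {t : ℝ} {x y : Euc 2}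
    (h : quadrantForm e t x = quadrantForm e t y) (hd : signedDiff e x = signedDiff e y) :
    x = y := by
  have h0 : boolSign e.1 * x 0 = boolSign e.1 * y 0 := by
    unfold quadrantForm at h
    unfold signedDiff at hd
    linear_combination h - t * hd
  have h1 : boolSign e.2 * x 1 = boolSign e.2 * y 1 := by
    unfold signedDiff at hd
    linear_combination h0 + hd
  have aux : ∀ (b : Bool) (u v : ℝ), boolSign b * u = boolSign b * v → u = v := by
    intro b u v huv
    linear_combination boolSign b * huv + (v - u) * boolSign_mul_self b
  ext k
  fin_cases k
  · exact aux _ _ _ h0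
  · exact aux _ _ _ h1

theorem abs_signedDiff_le (e : Bool × Bool) (x : Euc 2) : |signedDiff e x| ≤ 2 * ‖x‖ := by
  have h0 : |boolSign e.1 * x 0| ≤ ‖x‖ := by
    rw [abs_mul, abs_boolSign, one_mul]
    exact PiLp.norm_apply_le x 0
  have h1 : |boolSign e.2 * x 1| ≤ ‖x‖ := by
    rw [abs_mul, abs_boolSign, one_mul]
    exact PiLp.norm_apply_le x 1
  unfold signedDiff
  exact (abs_sub _ _).trans (by linarith)

theorem isClosed_gapEvent {n : ℕ} (e : Bool × Bool) (δ : ℝ) (i : Fin n) :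
    IsClosed (gapEvent e δ i) := by
  have hC : IsClosed {p : Icc (0 : ℝ) 1 × (Fin n → Euc 2) |
      ∀ j, j ≠ i → quadrantForm e p.1 (p.2 j) + δ ≤ quadrantForm e p.1 (p.2 i)} := by
    have hcont : ∀ k, Continuous fun p : Icc (0 : ℝ) 1 × (Fin n → Euc 2) =>
        quadrantForm e p.1 (p.2 k) := fun k =>
      (continuous_quadrantForm e).comp
        (f := fun p : Icc (0 : ℝ) 1 × (Fin n → Euc 2) => ((p.1 : ℝ), p.2 k)) (by fun_prop)
    simp only [ofPred_forall]
    exact isClosed_iInter fun j => isClosed_iInter fun _ =>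
      isClosed_le ((hcont j).add continuous_const) (hcont i)
  convert isClosedMap_snd_of_compactSpace _ hC using 1
  ext ω
  simp [gapEvent]

open Classical in
/-- A packing bound for the points separated from the others with margin `δ`. -/
theorem card_gapEvent_le {n : ℕ} (e : Bool × Bool) {δ α M : ℝ} (hδ : 0 < δ) (hα : 0 < α)
    (hM : 0 ≤ M) (ω : Fin n → Euc 2) (hω : ∀ i, ‖ω i‖ ≤ M) :
    ((Finset.univ.filter fun i => ω ∈ gapEvent e δ i).card : ℝ) ≤
      2 + (4 * M * α + α⁻¹) / Real.sqrt (8 * δ) := by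
  set S := Finset.univ.filter fun i => ω ∈ gapEvent e δ i
  have hmem : ∀ i ∈ S, ω ∈ gapEvent e δ i := fun i hi => (Finset.mem_filter.mp hi).2
  choose! t ht hgap using hmem
  set r := Real.sqrt (8 * δ) with hr
  have hr0 : 0 < r := Real.sqrt_pos.mpr (by positivity)
  have hrsq : r ^ 2 = 8 * δ := Real.sq_sqrt (by positivity)
  let p : Fin n → ℝ := fun i => α * signedDiff e (ω i) + α⁻¹ * t i
  have hsep : ∀ i ∈ S, ∀ j ∈ S, i ≠ j → r ≤ |p i - p j| := by
    intro i hi j hj hij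
    have h1 := hgap i hi j hij.symm
    have h2 := hgap j hj i hij
    have h3 := quadrantForm_eq e (t j) (t i) (ω i)
    have h4 := quadrantForm_eq e (t j) (t i) (ω j)
    have h5 : 2 * δ ≤ (t i - t j) * (signedDiff e (ω i) - signedDiff e (ω j)) := by
      nlinarith
    refine abs_le_of_sq_le_sq' ?_ (abs_nonneg _) |>.2
    rw [sq_abs, hrsq]
    have h6 : (p i - p j) ^ 2 =
        (α * (signedDiff e (ω i) - signedDiff e (ω j)) - α⁻¹ * (t i - t j)) ^ 2 +
          4 * ((t i - t j) * (signedDiff e (ω i) - signedDiff e (ω j))) := by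
      simp only [p]
      field_simp
      ring
    rw [h6]
    nlinarith [sq_nonneg (α * (signedDiff e (ω i) - signedDiff e (ω j)) - α⁻¹ * (t i - t j))]
  have hlo : ∀ i ∈ S, -(2 * M * α) ≤ p i := by
    intro i hi
    have h1 := (abs_le.mp (abs_signedDiff_le e (ω i))).1
    have h2 : 0 ≤ α⁻¹ * t i := mul_nonneg (by positivity) (ht i hi).1
    simp only [p]
    nlinarith [hω i]
  have hhi : ∀ i ∈ S, p i ≤ 2 * M * α + α⁻¹ := by
    intro i hi
    have h1 := (abs_le.mp (abs_signedDiff_le e (ω i))).2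
    have h2 : α⁻¹ * t i ≤ α⁻¹ * 1 := mul_le_mul_of_nonneg_left (ht i hi).2 (by positivity)
    simp only [p]
    nlinarith [hω i]
  have hcard : S.card ≤
      (Finset.Icc ⌊-(2 * M * α) / r⌋ ⌊(2 * M * α + α⁻¹) / r⌋).card := by
    refine Finset.card_le_card_of_injOn (fun i => ⌊p i / r⌋) ?_ ?_
    · intro i hi
      simp only [Finset.coe_Icc, mem_Icc]
      exact ⟨Int.floor_le_floor (div_le_div_of_nonneg_right (hlo i hi) hr0.le),
        Int.floor_le_floor (div_le_div_of_nonneg_right (hhi i hi) hr0.le)⟩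
    · intro i hi j hj hij
      by_contra hne
      have h1 := Int.abs_sub_lt_one_of_floor_eq_floor hij
      rw [← sub_div, abs_div, abs_of_pos hr0, div_lt_one hr0] at h1
      exact absurd (hsep i hi j hj hne) (not_le.mpr h1)
  have hle : -(2 * M * α) / r ≤ (2 * M * α + α⁻¹) / r := by
    have : 0 ≤ 2 * M * α := by positivity
    have : 0 < α⁻¹ := by positivity
    exact div_le_div_of_nonneg_right (by linarith) hr0.le
  rw [Int.card_Icc] at hcard
  have hcast : ((⌊(2 * M * α + α⁻¹) / r⌋ + 1 - ⌊-(2 * M * α) / r⌋).toNat : ℝ) =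
      (⌊(2 * M * α + α⁻¹) / r⌋ : ℝ) + 1 - ⌊-(2 * M * α) / r⌋ := by
    have : (0 : ℤ) ≤ ⌊(2 * M * α + α⁻¹) / r⌋ + 1 - ⌊-(2 * M * α) / r⌋ := by
      have := Int.floor_le_floor hle
      omega
    rw [← Int.cast_natCast, Int.toNat_of_nonneg this]
    push_cast
    ring
  have h1 : (S.card : ℝ) ≤ (⌊(2 * M * α + α⁻¹) / r⌋ : ℝ) + 1 - ⌊-(2 * M * α) / r⌋ := by
    rw [← hcast]
    exact_mod_cast hcard
  have h2 := Int.floor_le ((2 * M * α + α⁻¹) / r)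
  have h3 := Int.sub_one_lt_floor (-(2 * M * α) / r)
  have h4 : (4 * M * α + α⁻¹) / r = (2 * M * α + α⁻¹) / r - -(2 * M * α) / r := by
    rw [← sub_div]
    ring
  linarith

theorem exists_quadrantForm (l : StrongDual ℝ (Euc 2)) (hl : l ≠ 0) :
    ∃ (e : Bool × Bool) (c t : ℝ), 0 < c ∧ t ∈ Icc (0 : ℝ) 1 ∧
      ∀ x, l x = c * quadrantForm e t x := by
  have hrep : ∀ x : Euc 2, l x = l (EuclideanSpace.single 0 1) * x 0 +
      l (EuclideanSpace.single 1 1) * x 1 := by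
    intro x
    have hx : x = x 0 • EuclideanSpace.single (0 : Fin 2) (1 : ℝ) +
        x 1 • EuclideanSpace.single (1 : Fin 2) (1 : ℝ) := by
      ext k
      fin_cases k <;> simp
    conv_lhs => rw [hx]
    simp [mul_comm]
  set a := l (EuclideanSpace.single 0 1)
  set b := l (EuclideanSpace.single 1 1)
  have hc : 0 < |a| + |b| := by
    refine lt_of_le_of_ne (by positivity) fun h => hl ?_
    have ha : a = 0 := by
      have := abs_nonneg a
      have := abs_nonneg b
      exact abs_eq_zero.mp (by linarith)
    have hb : b = 0 := by
      have := abs_nonneg a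
      have := abs_nonneg b
      exact abs_eq_zero.mp (by linarith)
    ext x
    rw [hrep, ha, hb]
    simp
  have hsign : ∀ u : ℝ, ∃ s : Bool, u = |u| * boolSign s := by
    intro u
    rcases le_total 0 u with h | h
    · exact ⟨true, by simp [boolSign, abs_of_nonneg h]⟩
    · exact ⟨false, by simp [boolSign, abs_of_nonpos h]⟩
  obtain ⟨s₀, h₀⟩ := hsign a
  obtain ⟨s₁, h₁⟩ := hsign b
  refine ⟨(s₀, s₁), |a| + |b|, |b| / (|a| + |b|), hc, ⟨by positivity, ?_⟩, fun x => ?_⟩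
  · rw [div_le_one hc]
    linarith [abs_nonneg a]
  · rw [hrep]
    simp only [quadrantForm]
    have : (|a| + |b|) * (|b| / (|a| + |b|)) = |b| := by field_simp
    linear_combination x 0 * h₀ + x 1 * h₁ +
      (boolSign s₀ * x 0 - boolSign s₁ * x 1) * this

/-- An exposed face of positive dimension of the convex hull of finitely many points contains
two of these points. -/
theorem exists_ne_mem_of_isExposed {n d : ℕ} (ω : Fin n → Euc d) {F : Set (Euc d)}
    (hF : IsExposed ℝ (convexHull ℝ (range ω)) F)
    (hdim : Module.finrank ℝ (vectorSpan ℝ F) = 1) :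
    ∃ i j, ω i ∈ F ∧ ω j ∈ F ∧ ω i ≠ ω j := by
  have hcomp : IsCompact (convexHull ℝ (range ω)) := (finite_range ω).isCompact_convexHull (𝕜 := ℝ)
  have hKM := closure_convexHull_extremePoints (hF.isCompact hcomp)
    (hF.convex (convex_convexHull ℝ _))
  have hext : F.extremePoints ℝ ⊆ F ∩ range ω := fun x hx =>
    ⟨hx.1, extremePoints_convexHull_subset (hF.isExtreme.extremePoints_subset_extremePoints hx)⟩
  by_contra! hcon
  have hsub : (F.extremePoints ℝ).Subsingleton := by
    intro x hx y hy
    obtain ⟨hxF, i, rfl⟩ := hext hx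
    obtain ⟨hyF, j, rfl⟩ := hext hy
    exact hcon i j hxF hyF
  have hFsub : F.Subsingleton := by
    rw [← hKM]
    rcases hsub.eq_empty_or_singleton with h | ⟨x, h⟩ <;> simp [h]
  rw [vectorSpan_of_subsingleton ℝ hFsub] at hdim
  simp at hdim

/-- A proper edge of the convex hull of finitely many points, together with the endpoint of it at
which the signed coordinate difference is largest. -/
theorem exists_endpoint_of_isExposed {n : ℕ} (ω : Fin n → Euc 2) {F : Set (Euc 2)}
    (hF : IsExposed ℝ (convexHull ℝ (range ω)) F)
    (hdim : Module.finrank ℝ (vectorSpan ℝ F) = 1) (hne : F ≠ convexHull ℝ (range ω)) :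
    ∃ (e : Bool × Bool) (i : Fin n) (t : ℝ), t ∈ Icc (0 : ℝ) 1 ∧
      F = {x ∈ convexHull ℝ (range ω) | ∀ y ∈ convexHull ℝ (range ω),
        quadrantForm e t y ≤ quadrantForm e t x} ∧
      ω i ∈ F ∧ ∃ j, ω j ∈ F ∧ signedDiff e (ω j) < signedDiff e (ω i) := by
  obtain ⟨i₀, j₀, hi₀, hj₀, hij₀⟩ := exists_ne_mem_of_isExposed ω hF hdim
  obtain ⟨l, hl⟩ := hF ⟨_, hi₀⟩
  have hl0 : l ≠ 0 := by
    rintro rfl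
    apply hne
    rw [hl]
    simp
  obtain ⟨e, c, t, hc, ht, hlt⟩ := exists_quadrantForm l hl0
  have hFt : F = {x ∈ convexHull ℝ (range ω) | ∀ y ∈ convexHull ℝ (range ω),
      quadrantForm e t y ≤ quadrantForm e t x} := by
    rw [hl]
    simp only [hlt, mul_le_mul_iff_right₀ hc]
  have hinj : ∀ x ∈ F, ∀ y ∈ F, signedDiff e x = signedDiff e y → x = y := by
    intro x hx y hy hxy
    rw [hFt] at hx hy
    exact eq_of_quadrantForm_eq (le_antisymm (hy.2 x hx.1) (hx.2 y hy.1)) hxy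
  obtain ⟨i, hi, hmax⟩ := (toFinite {i | ω i ∈ F}).exists_maximalFor
    (fun i => signedDiff e (ω i)) _ ⟨i₀, hi₀⟩
  have hmax' : ∀ j, ω j ∈ F → signedDiff e (ω j) ≤ signedDiff e (ω i) := fun j hj =>
    (le_total _ _).elim id fun h => hmax hj h
  refine ⟨e, i, t, ht, hFt, hi, ?_⟩
  by_cases h : ω i₀ = ω i
  · exact ⟨j₀, hj₀, lt_of_le_of_ne (hmax' _ hj₀) fun h' =>
      hij₀ (h.trans (hinj _ hj₀ _ hi h').symm)⟩
  · exact ⟨i₀, hi₀, lt_of_le_of_ne (hmax' _ hi₀) fun h' => h (hinj _ hi₀ _ hi h')⟩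

/-- If `p` beats `q` for the parameter `s`, but not for `t`, and has the larger signed coordinate
difference, then `t ≤ s`. -/
theorem quadrant_parameter_le {e : Bool × Bool} {s t : ℝ} {p q : Euc 2}
    (hst : quadrantForm e s q ≤ quadrantForm e s p)
    (hpq : quadrantForm e t p ≤ quadrantForm e t q)
    (hd : signedDiff e q < signedDiff e p) : t ≤ s := by
  have h1 := quadrantForm_eq e s t p
  have h2 := quadrantForm_eq e s t q
  by_contra! h
  nlinarith

open Classical in
theorem edgeCount_convexHull_le {n : ℕ} [NeZero n] (ω : Fin n → Euc 2) :
    edgeCount (convexHull ℝ (range ω)) ≤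
      1 + ∑ e : Bool × Bool, (Finset.univ.filter fun i => ω ∈ gapEvent e 0 i).card := by
  set S := convexHull ℝ (range ω)
  set 𝓕 := {F : Set (Euc 2) | IsExposed ℝ S F ∧ Module.finrank ℝ (vectorSpan ℝ F) = 1}
  have hsub : ∀ i, ω i ∈ S := fun i => subset_convexHull ℝ _ (mem_range_self i)
  have hex : ∀ F ∈ 𝓕 \ {S}, ∃ (e : Bool × Bool) (i : Fin n) (t : ℝ), t ∈ Icc (0 : ℝ) 1 ∧
      F = {x ∈ S | ∀ y ∈ S, quadrantForm e t y ≤ quadrantForm e t x} ∧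
      ω i ∈ F ∧ ∃ j, ω j ∈ F ∧ signedDiff e (ω j) < signedDiff e (ω i) := fun F hF =>
    exists_endpoint_of_isExposed ω hF.1.1 hF.1.2 hF.2
  choose! e i t ht hFeq hi j hj hlt using hex
  let T : Finset ((Bool × Bool) × Fin n) :=
    Finset.univ.filter fun q => ω ∈ gapEvent q.1 0 q.2
  have hmax : ∀ F ∈ 𝓕 \ {S}, ∀ x ∈ F, ∀ y ∈ S,
      quadrantForm (e F) (t F) y ≤ quadrantForm (e F) (t F) x := by
    intro F hF x hx
    rw [hFeq F hF] at hx
    exact hx.2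
  have hcard : (𝓕 \ {S}).ncard ≤ (T : Set ((Bool × Bool) × Fin n)).ncard := by
    refine ncard_le_ncard_of_injOn (fun F => (e F, i F)) ?_ ?_ (Finset.finite_toSet _)
    · intro F hF
      simp only [T, Finset.coe_filter, Finset.mem_univ, true_and, mem_ofPred_eq]
      refine ⟨t F, ht F hF, fun k _ => ?_⟩
      rw [add_zero]
      exact hmax F hF _ (hi F hF) _ (hsub k)
    · intro F hF G hG hFG
      obtain ⟨he, hiFG⟩ := Prod.mk.inj hFG
      have htFG : t F = t G := by
        apply le_antisymm
        · refine quadrant_parameter_le (e := e F) (p := ω (i F)) (q := ω (j F)) ?_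
            (hmax F hF _ (hj F hF) _ (hsub _)) (hlt F hF)
          rw [he, hiFG]
          exact hmax G hG _ (hi G hG) _ (hsub _)
        · refine quadrant_parameter_le (e := e G) (p := ω (i G)) (q := ω (j G)) ?_
            (hmax G hG _ (hj G hG) _ (hsub _)) (hlt G hG)
          rw [← he, ← hiFG]
          exact hmax F hF _ (hi F hF) _ (hsub _)
      rw [hFeq F hF, hFeq G hG, he, htFG]
  have hT : T.card = ∑ e : Bool × Bool,
      (Finset.univ.filter fun i => ω ∈ gapEvent e 0 i).card := by
    simp only [T, Finset.card_filter]
    rw [Fintype.sum_prod_type]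
  rw [ncard_coe_finset, hT] at hcard
  have := ncard_le_ncard_sdiff_add_ncard 𝓕 {S}
  rw [ncard_singleton] at this
  change 𝓕.ncard ≤ _
  omega

theorem integral_exp_neg_mul_sq_norm_sub {b : ℝ} (hb : 0 < b) (m : Euc 2) :
    ∫ x : Euc 2, Real.exp (-b * ‖x - m‖ ^ 2) = Real.pi / b := by
  rw [integral_sub_right_eq_self (fun x : Euc 2 => Real.exp (-b * ‖x‖ ^ 2)) m,
    GaussianFourier.integral_rexp_neg_mul_sq_norm hb]
  simp

theorem gaussPdf_nonneg (d : ℕ) (m : Euc d) (σ : ℝ) (x : Euc d) : 0 ≤ gaussPdf d m σ x := by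
  unfold gaussPdf
  positivity

theorem continuous_gaussPdf (d : ℕ) (m : Euc d) (σ : ℝ) : Continuous (gaussPdf d m σ) := by
  unfold gaussPdf
  fun_prop

theorem gaussPdf_two {σ : ℝ} (m x : Euc 2) :
    gaussPdf 2 m σ x = (2 * Real.pi * σ ^ 2)⁻¹ * Real.exp (-(1 / (2 * σ ^ 2)) * ‖x - m‖ ^ 2) := by
  unfold gaussPdf
  rw [inv_pow, Real.sq_sqrt (by positivity)]
  congr 2
  ring

theorem integral_gaussPdf {σ : ℝ} (hσ : 0 < σ) (m : Euc 2) : ∫ x, gaussPdf 2 m σ x = 1 := by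
  simp_rw [gaussPdf_two]
  rw [integral_const_mul, integral_exp_neg_mul_sq_norm_sub (by positivity)]
  have := Real.pi_pos
  field_simp

theorem integral_gaussPdf_mul_exp {σ : ℝ} (hσ : 0 < σ) (m : Euc 2) :
    ∫ x, gaussPdf 2 m σ x * Real.exp (‖x - m‖ ^ 2 / (4 * σ ^ 2)) = 2 := by
  have h : ∀ x, gaussPdf 2 m σ x * Real.exp (‖x - m‖ ^ 2 / (4 * σ ^ 2)) =
      (2 * Real.pi * σ ^ 2)⁻¹ * Real.exp (-(1 / (4 * σ ^ 2)) * ‖x - m‖ ^ 2) := by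
    intro x
    rw [gaussPdf_two, mul_assoc, ← Real.exp_add]
    congr 2
    field_simp
    ring
  simp_rw [h]
  rw [integral_const_mul, integral_exp_neg_mul_sq_norm_sub (by positivity)]
  have := Real.pi_pos
  field_simp
  norm_num

theorem lintegral_ofReal_prod {n d : ℕ} (f : Fin n → Euc d → ℝ) (hf : ∀ i x, 0 ≤ f i x)
    (hint : ∀ i, Integrable (f i)) :
    ∫⁻ ω : Fin n → Euc d, ENNReal.ofReal (∏ i, f i (ω i)) =
      ENNReal.ofReal (∏ i, ∫ x, f i x) := by
  rw [← integral_fintype_prod_volume_eq_prod, ofReal_integral_eq_lintegral_ofReal]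
  · exact Integrable.fintype_prod hint
  · exact ae_of_all _ fun ω => Finset.prod_nonneg fun i _ => hf i _

/-- Density of `jointGaussian`. -/
def jointPdf {n : ℕ} (m : Fin n → Euc 2) (σ : ℝ) (ω : Fin n → Euc 2) : ℝ :=
  ∏ i, gaussPdf 2 (m i) σ (ω i)

/-- The exponential weight `exp (‖a_i - m_i‖² / (4 σ²))`. -/
def expWeight {n : ℕ} (m : Fin n → Euc 2) (σ : ℝ) (i : Fin n) (ω : Fin n → Euc 2) : ℝ :=
  Real.exp (‖ω i - m i‖ ^ 2 / (4 * σ ^ 2))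

theorem jointPdf_nonneg {n : ℕ} (m : Fin n → Euc 2) (σ : ℝ) (ω : Fin n → Euc 2) :
    0 ≤ jointPdf m σ ω :=
  Finset.prod_nonneg fun _ _ => gaussPdf_nonneg _ _ _ _

theorem measurable_jointPdf {n : ℕ} (m : Fin n → Euc 2) (σ : ℝ) :
    Measurable fun ω => ENNReal.ofReal (jointPdf m σ ω) := by
  refine ENNReal.measurable_ofReal.comp (Continuous.measurable ?_)
  exact continuous_finsetProd _ fun i _ =>
    (continuous_gaussPdf 2 (m i) σ).comp (continuous_apply i)

theorem measurable_expWeight {n : ℕ} (m : Fin n → Euc 2) (σ : ℝ) (i : Fin n) :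
    Measurable fun ω => ENNReal.ofReal (expWeight m σ i ω) := by
  refine ENNReal.measurable_ofReal.comp (Continuous.measurable ?_)
  unfold expWeight
  fun_prop

theorem jointGaussian_eq {n : ℕ} (m : Fin n → Euc 2) (σ : ℝ) :
    jointGaussian n 2 m σ = volume.withDensity fun ω => ENNReal.ofReal (jointPdf m σ ω) :=
  rfl

theorem lintegral_jointGaussian {n : ℕ} (m : Fin n → Euc 2) (σ : ℝ)
    {g : (Fin n → Euc 2) → ℝ≥0∞} (hg : Measurable g) :
    ∫⁻ ω, g ω ∂(jointGaussian n 2 m σ) = ∫⁻ ω, ENNReal.ofReal (jointPdf m σ ω) * g ω := by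
  rw [jointGaussian_eq, lintegral_withDensity_eq_lintegral_mul _ (measurable_jointPdf m σ) hg]
  rfl

theorem integrable_gaussPdf {σ : ℝ} (hσ : 0 < σ) (m : Euc 2) : Integrable (gaussPdf 2 m σ) :=
  Integrable.of_integral_ne_zero (by rw [integral_gaussPdf hσ]; norm_num)

theorem jointGaussian_univ {n : ℕ} (m : Fin n → Euc 2) {σ : ℝ} (hσ : 0 < σ) :
    jointGaussian n 2 m σ univ = 1 := by
  rw [jointGaussian_eq, withDensity_apply _ MeasurableSet.univ, Measure.restrict_univ]
  unfold jointPdf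
  rw [lintegral_ofReal_prod (fun i => gaussPdf 2 (m i) σ) (fun i => gaussPdf_nonneg _ _ _)
    (fun i => integrable_gaussPdf hσ _)]
  simp [integral_gaussPdf hσ]

theorem lintegral_expWeight {n : ℕ} (m : Fin n → Euc 2) {σ : ℝ} (hσ : 0 < σ) (i : Fin n) :
    ∫⁻ ω, ENNReal.ofReal (expWeight m σ i ω) ∂(jointGaussian n 2 m σ) = 2 := by
  rw [lintegral_jointGaussian _ _ (measurable_expWeight m σ i)]
  let f : Fin n → Euc 2 → ℝ := fun k x => gaussPdf 2 (m k) σ x *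
    if k = i then Real.exp (‖x - m k‖ ^ 2 / (4 * σ ^ 2)) else 1
  have hval : ∀ k, ∫ x, f k x = if k = i then 2 else 1 := by
    intro k
    by_cases hk : k = i
    · simp only [f, hk, if_true]
      exact integral_gaussPdf_mul_exp hσ _
    · simp only [f, hk, if_false, mul_one]
      exact integral_gaussPdf hσ _
  have hprod : ∀ ω : Fin n → Euc 2, ENNReal.ofReal (jointPdf m σ ω) *
      ENNReal.ofReal (expWeight m σ i ω) = ENNReal.ofReal (∏ k, f k (ω k)) := by
    intro ω
    rw [← ENNReal.ofReal_mul (jointPdf_nonneg m σ ω)]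
    simp only [f, Finset.prod_mul_distrib, Finset.prod_ite_eq', Finset.mem_univ, if_true]
    rfl
  simp_rw [hprod]
  rw [lintegral_ofReal_prod f]
  · simp [hval]
  · intro k x
    refine mul_nonneg (gaussPdf_nonneg _ _ _ _) ?_
    split_ifs <;> positivity
  · intro k
    refine Integrable.of_integral_ne_zero ?_
    rw [hval]
    split_ifs <;> norm_num

/-- The vector on which every form of the quadrant `e` takes the value one. -/
def quadrantDir (e : Bool × Bool) : Euc 2 := !₂[boolSign e.1, boolSign e.2]

theorem norm_quadrantDir_le (e : Bool × Bool) : ‖quadrantDir e‖ ≤ 2 := by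
  rw [EuclideanSpace.norm_eq, Real.sqrt_le_left (by norm_num)]
  simp only [Fin.sum_univ_two, quadrantDir, Matrix.cons_val_zero, Matrix.cons_val_one,
    Real.norm_eq_abs, abs_boolSign]
  norm_num

theorem quadrantForm_add_smul_quadrantDir (e : Bool × Bool) (t δ : ℝ) (x : Euc 2) :
    quadrantForm e t (x + δ • quadrantDir e) = quadrantForm e t x + δ := by
  simp only [quadrantForm, quadrantDir, PiLp.add_apply, PiLp.smul_apply, smul_eq_mul,
    Matrix.cons_val_zero, Matrix.cons_val_one]
  linear_combination (1 - t) * δ * boolSign_mul_self e.1 + t * δ * boolSign_mul_self e.2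

theorem add_single_mem_gapEvent {n : ℕ} {e : Bool × Bool} {i : Fin n} {ω : Fin n → Euc 2}
    (h : ω ∈ gapEvent e 0 i) (δ : ℝ) :
    ω + Pi.single i (δ • quadrantDir e) ∈ gapEvent e δ i := by
  obtain ⟨t, ht, hgap⟩ := h
  refine ⟨t, ht, fun j hj => ?_⟩
  have := hgap j hj
  simp only [Pi.add_apply, Pi.single_eq_same, Pi.single_eq_of_ne hj, add_zero,
    quadrantForm_add_smul_quadrantDir] at this ⊢
  linarith

theorem gaussPdf_le_exp_mul_gaussPdf_add {d : ℕ} {σ L : ℝ} (hσ : 0 < σ) (hL : 1 ≤ L)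
    {m x v : Euc d} (hx : ‖x - m‖ ≤ 2 * σ * L) (hv : ‖v‖ ≤ 2 * (σ / L)) :
    gaussPdf d m σ x ≤ Real.exp 6 * gaussPdf d m σ (x + v) := by
  have hL0 : 0 < L := by linarith
  have hnorm : ‖x + v - m‖ ≤ ‖x - m‖ + ‖v‖ := by
    rw [show x + v - m = (x - m) + v by abel]
    exact norm_add_le _ _
  have hxv : ‖x - m‖ * ‖v‖ ≤ 4 * σ ^ 2 :=
    (mul_le_mul hx hv (norm_nonneg _) (by positivity)).trans_eq (by field_simp; norm_num)
  have hvσ : ‖v‖ ≤ 2 * σ := by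
    have : σ / L ≤ σ := div_le_self hσ.le hL
    linarith
  have hkey : ‖x + v - m‖ ^ 2 ≤ ‖x - m‖ ^ 2 + 12 * σ ^ 2 := by
    have h1 : ‖x + v - m‖ ^ 2 ≤ (‖x - m‖ + ‖v‖) ^ 2 := by gcongr
    have h2 : ‖v‖ ^ 2 ≤ (2 * σ) ^ 2 := by gcongr
    nlinarith
  unfold gaussPdf
  rw [mul_left_comm, ← Real.exp_add]
  refine mul_le_mul_of_nonneg_left (Real.exp_le_exp.mpr ?_) (by positivity)
  have h6 : (6 : ℝ) = 12 * σ ^ 2 / (2 * σ ^ 2) := by field_simp; norm_num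
  rw [h6, ← add_div]
  gcongr
  linarith

theorem jointPdf_le_exp_mul_jointPdf_add {n : ℕ} (m : Fin n → Euc 2) {σ L : ℝ} (hσ : 0 < σ)
    (hL : 1 ≤ L) {i : Fin n} {ω : Fin n → Euc 2} {v : Euc 2}
    (hω : ‖ω i - m i‖ ≤ 2 * σ * L) (hv : ‖v‖ ≤ 2 * (σ / L)) :
    jointPdf m σ ω ≤ Real.exp 6 * jointPdf m σ (ω + Pi.single i v) := by
  set ω' : Fin n → Euc 2 := ω + Pi.single i v with hω'
  unfold jointPdf
  rw [← Finset.mul_prod_erase _ (fun k => gaussPdf 2 (m k) σ (ω k)) (Finset.mem_univ i),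
    ← Finset.mul_prod_erase _ (fun k => gaussPdf 2 (m k) σ (ω' k))
      (Finset.mem_univ i), ← mul_assoc]
  have herase : ∏ k ∈ Finset.univ.erase i, gaussPdf 2 (m k) σ (ω' k) =
      ∏ k ∈ Finset.univ.erase i, gaussPdf 2 (m k) σ (ω k) := by
    refine Finset.prod_congr rfl fun k hk => ?_
    rw [hω', Pi.add_apply, Pi.single_eq_of_ne (Finset.ne_of_mem_erase hk), add_zero]
  rw [herase]
  refine mul_le_mul_of_nonneg_right ?_ (Finset.prod_nonneg fun _ _ => gaussPdf_nonneg _ _ _ _)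
  rw [hω', Pi.add_apply, Pi.single_eq_same]
  exact gaussPdf_le_exp_mul_gaussPdf_add hσ hL hω hv

/-- Being separated at all is not much likelier than being separated with margin
`σ / √(log n)`. -/
theorem jointGaussian_gapEvent_le {n : ℕ} (m : Fin n → Euc 2) {σ L : ℝ} (hσ : 0 < σ)
    (hL : 1 ≤ L) (hn : Real.exp (L ^ 2) = n) (e : Bool × Bool) (i : Fin n) :
    jointGaussian n 2 m σ (gapEvent e 0 i) ≤
      ENNReal.ofReal (Real.exp 6) * jointGaussian n 2 m σ (gapEvent e (σ / L) i) +
        ENNReal.ofReal (n : ℝ)⁻¹ * 2 := by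
  have hL0 : 0 < L := by linarith
  have hn0 : (0 : ℝ) < n := hn ▸ Real.exp_pos _
  set v : Euc 2 := (σ / L) • quadrantDir e with hvdef
  have hv : ‖v‖ ≤ 2 * (σ / L) := by
    rw [hvdef, norm_smul, Real.norm_of_nonneg (by positivity), mul_comm]
    exact mul_le_mul_of_nonneg_right (norm_quadrantDir_le e) (by positivity)
  have hmeas : ∀ δ, MeasurableSet (gapEvent e δ i) := fun δ =>
    (isClosed_gapEvent e δ i).measurableSet
  let ρ : (Fin n → Euc 2) → ℝ≥0∞ := fun ω => ENNReal.ofReal (jointPdf m σ ω)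
  let W : (Fin n → Euc 2) → ℝ≥0∞ := fun ω => ENNReal.ofReal (expWeight m σ i ω)
  have hρ : Measurable ρ := measurable_jointPdf m σ
  have hW : Measurable W := measurable_expWeight m σ i
  have hset : ∀ δ, jointGaussian n 2 m σ (gapEvent e δ i) =
      ∫⁻ ω, (gapEvent e δ i).indicator ρ ω := by
    intro δ
    rw [jointGaussian_eq, withDensity_apply _ (hmeas δ), lintegral_indicator (hmeas δ)]
  have hpt : ∀ ω, (gapEvent e 0 i).indicator ρ ω ≤
      ENNReal.ofReal (Real.exp 6) *
        (gapEvent e (σ / L) i).indicator ρ (ω + Pi.single i v) +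
        ENNReal.ofReal (n : ℝ)⁻¹ * (ρ ω * W ω) := by
    intro ω
    by_cases hω : ω ∈ gapEvent e 0 i
    · rw [indicator_of_mem hω, indicator_of_mem (add_single_mem_gapEvent hω _)]
      by_cases hz : ‖ω i - m i‖ ≤ 2 * σ * L
      · refine le_add_right ?_
        rw [← ENNReal.ofReal_mul (Real.exp_pos _).le]
        exact ENNReal.ofReal_le_ofReal (jointPdf_le_exp_mul_jointPdf_add m hσ hL hz hv)
      · refine le_add_left ?_
        rw [← ENNReal.ofReal_mul (jointPdf_nonneg m σ ω), ← ENNReal.ofReal_mul (by positivity)]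
        refine ENNReal.ofReal_le_ofReal ?_
        have hexp : (n : ℝ) ≤ expWeight m σ i ω := by
          rw [← hn]
          refine Real.exp_le_exp.mpr ?_
          rw [le_div_iff₀ (by positivity)]
          have : (2 * σ * L) ^ 2 ≤ ‖ω i - m i‖ ^ 2 :=
            pow_le_pow_left₀ (by positivity) (not_le.mp hz).le 2
          linarith
        rw [inv_mul_eq_div, le_div_iff₀ hn0]
        exact mul_le_mul_of_nonneg_left hexp (jointPdf_nonneg m σ ω)
    · rw [indicator_of_notMem hω]
      exact zero_le
  rw [hset, hset]
  refine (lintegral_mono hpt).trans_eq ?_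
  have hρW : Measurable fun ω => ρ ω * W ω := hρ.mul hW
  have hshift : Measurable fun ω : Fin n → Euc 2 =>
      (gapEvent e (σ / L) i).indicator ρ (ω + Pi.single i v) :=
    (hρ.indicator (hmeas _)).comp (measurable_add_const _)
  rw [lintegral_add_right _ (hρW.const_mul _), lintegral_const_mul _ hρW,
    lintegral_const_mul _ hshift,
    lintegral_add_right_eq_self (fun ω => (gapEvent e (σ / L) i).indicator ρ ω),
    ← lintegral_jointGaussian m σ hW, lintegral_expWeight m hσ]

theorem le_mul_one_add_exp {r T : ℝ} (hT : 2 ≤ T) :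
    r ≤ T * (1 + Real.exp (r ^ 2 / 4 - T ^ 2 / 4)) := by
  have hT0 : 0 < T := by linarith
  rcases le_total r T with h | h
  · nlinarith [Real.exp_pos (r ^ 2 / 4 - T ^ 2 / 4)]
  · have hq : 1 ≤ r / T := (one_le_div hT0).mpr h
    have h1 : r / T ≤ (r / T) ^ 2 := by nlinarith
    have h2 : (r / T) ^ 2 - 1 ≤ r ^ 2 / 4 - T ^ 2 / 4 := by
      have : r ^ 2 / 4 - T ^ 2 / 4 = ((r / T) ^ 2 - 1) * (T ^ 2 / 4) := by field_simp
      rw [this]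
      have h3 : 0 ≤ (r / T) ^ 2 - 1 := by nlinarith
      exact le_mul_of_one_le_right h3 (by nlinarith)
    have h4 := Real.add_one_le_exp (r ^ 2 / 4 - T ^ 2 / 4)
    have h5 : r = T * (r / T) := by field_simp
    calc r = T * (r / T) := h5
      _ ≤ T * (1 + Real.exp (r ^ 2 / 4 - T ^ 2 / 4)) :=
        mul_le_mul_of_nonneg_left (by linarith) hT0.le

theorem norm_le_sum_expWeight {n : ℕ} {m : Fin n → Euc 2} (hm : ∀ i, ‖m i‖ ≤ 1) {σ L : ℝ}
    (hσ : 0 < σ) (hL : 1 ≤ L) (hn : Real.exp (L ^ 2) = n) (ω : Fin n → Euc 2) (i : Fin n) :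
    ‖ω i‖ ≤ 1 + 2 * σ * L * (1 + (n : ℝ)⁻¹ * ∑ k, expWeight m σ k ω) := by
  have h1 := le_mul_one_add_exp (r := ‖ω i - m i‖ / σ) (T := 2 * L) (by linarith)
  have h2 : Real.exp ((‖ω i - m i‖ / σ) ^ 2 / 4 - (2 * L) ^ 2 / 4) =
      (n : ℝ)⁻¹ * expWeight m σ i ω := by
    rw [← hn, ← Real.exp_neg, expWeight, ← Real.exp_add]
    congr 1
    field_simp
    ring
  have h3 : expWeight m σ i ω ≤ ∑ k, expWeight m σ k ω :=
    Finset.single_le_sum (f := fun k => expWeight m σ k ω) (fun k _ => (Real.exp_pos _).le)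
      (Finset.mem_univ i)
  rw [h2, div_le_iff₀ hσ] at h1
  have h4 : ‖ω i‖ ≤ ‖ω i - m i‖ + ‖m i‖ := by
    simpa using norm_add_le (ω i - m i) (m i)
  have h5 : 2 * L * (1 + (n : ℝ)⁻¹ * expWeight m σ i ω) * σ ≤
      2 * σ * L * (1 + (n : ℝ)⁻¹ * ∑ k, expWeight m σ k ω) := by
    rw [show 2 * L * (1 + (n : ℝ)⁻¹ * expWeight m σ i ω) * σ =
      2 * σ * L * (1 + (n : ℝ)⁻¹ * expWeight m σ i ω) by ring]
    gcongr
  linarith [hm i]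

open Classical in
theorem card_filter_mem_eq_sum_indicator {ι Ω : Type*} [Fintype ι] (E : ι → Set Ω) (ω : Ω) :
    ((Finset.univ.filter fun i => ω ∈ E i).card : ℝ≥0∞) =
      ∑ i, (E i).indicator (1 : Ω → ℝ≥0∞) ω := by
  simp only [Finset.natCast_card_filter, indicator_apply, Pi.one_apply]

/-- The expected number of points separated with margin `σ / √(log n)`. -/
theorem sum_jointGaussian_gapEvent_le {n : ℕ} {m : Fin n → Euc 2} (hm : ∀ i, ‖m i‖ ≤ 1)
    {σ L : ℝ} (hσ : 0 < σ) (hL : 1 ≤ L) (hn : Real.exp (L ^ 2) = n) (e : Bool × Bool) :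
    ∑ i, jointGaussian n 2 m σ (gapEvent e (σ / L) i) ≤
      ENNReal.ofReal (2 + 25 * (Real.sqrt (L / σ) + L)) := by
  classical
  have hL0 : 0 < L := by linarith
  have hn0 : (0 : ℝ) < n := hn ▸ Real.exp_pos _
  have hmeas : ∀ i : Fin n, MeasurableSet (gapEvent e (σ / L) i) := fun i =>
    (isClosed_gapEvent e _ i).measurableSet
  set r := Real.sqrt (8 * (σ / L)) with hr
  have hr0 : 0 < r := Real.sqrt_pos.mpr (by positivity)
  set q := Real.sqrt (1 + σ * L) with hq
  have hq0 : 0 < q := Real.sqrt_pos.mpr (by positivity)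
  have hqsq : q ^ 2 = 1 + σ * L := Real.sq_sqrt (by positivity)
  set A : ℝ := 2 + (4 * (1 + 2 * σ * L) * q⁻¹ + q) / r with hA
  set B : ℝ := 8 * σ * L * q⁻¹ / r * (n : ℝ)⁻¹ with hB
  have hA0 : 0 ≤ A := by positivity
  have hB0 : 0 ≤ B := by positivity
  have hpt : ∀ ω, ∑ i, (gapEvent e (σ / L) i).indicator (1 : (Fin n → Euc 2) → ℝ≥0∞) ω ≤
      ENNReal.ofReal A + ∑ k, ENNReal.ofReal B * ENNReal.ofReal (expWeight m σ k ω) := by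
    intro ω
    have hW : ∀ k, 0 ≤ expWeight m σ k ω := fun k => (Real.exp_pos _).le
    have hsum : 0 ≤ ∑ k, expWeight m σ k ω := Finset.sum_nonneg fun k _ => hW k
    have hcard := card_gapEvent_le e (δ := σ / L) (α := q⁻¹) (by positivity) (by positivity)
      (by positivity) ω (norm_le_sum_expWeight hm hσ hL hn ω)
    rw [← card_filter_mem_eq_sum_indicator, ← Finset.mul_sum,
      ← ENNReal.ofReal_sum_of_nonneg fun k _ => hW k, ← ENNReal.ofReal_mul hB0,
      ← ENNReal.ofReal_add hA0 (by positivity), ← ENNReal.ofReal_natCast]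
    refine ENNReal.ofReal_le_ofReal (hcard.trans_eq ?_)
    rw [hA, hB, inv_inv]
    ring
  calc ∑ i, jointGaussian n 2 m σ (gapEvent e (σ / L) i)
      = ∫⁻ ω, ∑ i, (gapEvent e (σ / L) i).indicator (1 : (Fin n → Euc 2) → ℝ≥0∞) ω
          ∂(jointGaussian n 2 m σ) := by
        rw [lintegral_finsetSum _ fun i _ => measurable_one.indicator (hmeas i)]
        simp_rw [lintegral_indicator_one (hmeas _)]
    _ ≤ ∫⁻ ω, (ENNReal.ofReal A + ∑ k, ENNReal.ofReal B * ENNReal.ofReal (expWeight m σ k ω))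
          ∂(jointGaussian n 2 m σ) := lintegral_mono hpt
    _ = ENNReal.ofReal A + n * (ENNReal.ofReal B * 2) := by
        rw [lintegral_add_left measurable_const, lintegral_const, jointGaussian_univ m hσ, mul_one,
          lintegral_finsetSum _ fun k _ => (measurable_expWeight m σ k).const_mul _]
        simp_rw [lintegral_const_mul _ (measurable_expWeight m σ _), lintegral_expWeight m hσ]
        simp
    _ = ENNReal.ofReal (A + n * (B * 2)) := by
        rw [ENNReal.ofReal_add hA0 (by positivity), ENNReal.ofReal_mul hn0.le,
          ENNReal.ofReal_mul hB0, ENNReal.ofReal_natCast, ENNReal.ofReal_ofNat]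
    _ ≤ ENNReal.ofReal (2 + 25 * (Real.sqrt (L / σ) + L)) := by
        refine ENNReal.ofReal_le_ofReal ?_
        have h1 : A + n * (B * 2) = 2 + (4 * (1 + 6 * σ * L) / q + q) / r := by
          rw [hA, hB]
          field_simp
          ring
        have h2 : 4 * (1 + 6 * σ * L) / q + q ≤ 25 * q := by
          have : 4 * (1 + 6 * σ * L) / q ≤ 24 * q := by
            rw [div_le_iff₀ hq0]
            nlinarith
          linarith
        have h3 : q / r ≤ Real.sqrt (L / σ) + L := by
          rw [hq, hr, ← Real.sqrt_div (by positivity), Real.sqrt_le_left (by positivity)]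
          have h4 : Real.sqrt (L / σ) ^ 2 = L / σ := Real.sq_sqrt (by positivity)
          have h5 : (1 + σ * L) / (8 * (σ / L)) = (L / σ + L ^ 2) / 8 := by
            field_simp
          have h6 : 0 ≤ L / σ := by positivity
          rw [h5]
          nlinarith [Real.sqrt_nonneg (L / σ)]
        calc A + n * (B * 2) = 2 + (4 * (1 + 6 * σ * L) / q + q) / r := h1
          _ ≤ 2 + 25 * q / r := by gcongr
          _ = 2 + 25 * (q / r) := by ring
          _ ≤ 2 + 25 * (Real.sqrt (L / σ) + L) := by gcongr

theorem lintegral_edgeCount_le {n : ℕ} {m : Fin n → Euc 2} (hm : ∀ i, ‖m i‖ ≤ 1)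
    {σ L : ℝ} (hσ : 0 < σ) (hL : 1 ≤ L) (hn : Real.exp (L ^ 2) = n) :
    ∫⁻ ω, (edgeCount (convexHull ℝ (range ω)) : ℝ≥0∞) ∂(jointGaussian n 2 m σ) ≤
      ENNReal.ofReal (9 + 4 * (Real.exp 6 * (2 + 25 * (Real.sqrt (L / σ) + L)))) := by
  classical
  have hL0 : 0 < L := by linarith
  have hn0 : (0 : ℝ) < n := hn ▸ Real.exp_pos _
  have : NeZero n := ⟨fun h => by simp [h] at hn0⟩
  have hmeas : ∀ e i, MeasurableSet (gapEvent (n := n) e 0 i) := fun e i =>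
    (isClosed_gapEvent e _ i).measurableSet
  have hquad : ∀ e, ∑ i, jointGaussian n 2 m σ (gapEvent e 0 i) ≤
      ENNReal.ofReal (Real.exp 6 * (2 + 25 * (Real.sqrt (L / σ) + L)) + 2) := by
    intro e
    calc ∑ i, jointGaussian n 2 m σ (gapEvent e 0 i)
        ≤ ∑ i, (ENNReal.ofReal (Real.exp 6) * jointGaussian n 2 m σ (gapEvent e (σ / L) i) +
            ENNReal.ofReal (n : ℝ)⁻¹ * 2) :=
          Finset.sum_le_sum fun i _ => jointGaussian_gapEvent_le m hσ hL hn e i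
      _ = ENNReal.ofReal (Real.exp 6) *
            ∑ i, jointGaussian n 2 m σ (gapEvent e (σ / L) i) + 2 := by
          rw [Finset.sum_add_distrib, ← Finset.mul_sum, Finset.sum_const, Finset.card_univ,
            Fintype.card_fin, nsmul_eq_mul, ← mul_assoc, ← ENNReal.ofReal_natCast,
            ← ENNReal.ofReal_mul hn0.le, mul_inv_cancel₀ hn0.ne', ENNReal.ofReal_one, one_mul]
      _ ≤ ENNReal.ofReal (Real.exp 6) *
            ENNReal.ofReal (2 + 25 * (Real.sqrt (L / σ) + L)) + 2 := by
          gcongr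
          exact sum_jointGaussian_gapEvent_le hm hσ hL hn e
      _ = ENNReal.ofReal (Real.exp 6 * (2 + 25 * (Real.sqrt (L / σ) + L)) + 2) := by
          rw [ENNReal.ofReal_add (p := Real.exp 6 * _) (by positivity) (by norm_num),
            ENNReal.ofReal_mul (Real.exp_pos _).le, ENNReal.ofReal_ofNat]
  calc ∫⁻ ω, (edgeCount (convexHull ℝ (range ω)) : ℝ≥0∞) ∂(jointGaussian n 2 m σ)
      ≤ ∫⁻ ω, (1 + ∑ e : Bool × Bool, ∑ i,
          (gapEvent e 0 i).indicator (1 : (Fin n → Euc 2) → ℝ≥0∞) ω)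
          ∂(jointGaussian n 2 m σ) := by
        refine lintegral_mono fun ω => ?_
        simp_rw [← card_filter_mem_eq_sum_indicator]
        exact_mod_cast edgeCount_convexHull_le ω
    _ = 1 + ∑ e : Bool × Bool, ∑ i, jointGaussian n 2 m σ (gapEvent e 0 i) := by
        rw [lintegral_add_left measurable_const, lintegral_const, jointGaussian_univ m hσ, mul_one,
          lintegral_finsetSum _ fun e _ => Finset.measurable_fun_sum _ fun i _ =>
            measurable_one.indicator (hmeas e i)]
        simp_rw [lintegral_finsetSum _ fun i _ => measurable_one.indicator (hmeas _ i),
          lintegral_indicator_one (hmeas _ _)]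
    _ ≤ 1 + ∑ _e : Bool × Bool,
          ENNReal.ofReal (Real.exp 6 * (2 + 25 * (Real.sqrt (L / σ) + L)) + 2) := by
        gcongr with e
        exact hquad e
    _ = ENNReal.ofReal (9 + 4 * (Real.exp 6 * (2 + 25 * (Real.sqrt (L / σ) + L)))) := by
        rw [← ENNReal.ofReal_sum_of_nonneg fun _ _ => by positivity, ← ENNReal.ofReal_one,
          ← ENNReal.ofReal_add zero_le_one (by positivity)]
        congr 1
        simp only [Finset.sum_const, Finset.card_univ, Fintype.card_prod, Fintype.card_bool,
          nsmul_eq_mul]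
        push_cast
        ring

/-- Two-dimensional upper bound.
If `ā_1,…,ā_n ∈ ℝ²` (`n > 2`) have norm at most one, `σ > 0`, and `a_i ∼ N(ā_i, σ² I₂)`
independently, then `E[edges(conv(a_1,…,a_n))] ≤ C ((log n)^(1/4)/√σ + √(log n))`
for a universal constant `C > 0`. -/
theorem stmt_1 :
    ∃ C : ℝ, 0 < C ∧
      ∀ (n : ℕ), 2 < n →
      ∀ (abar : Fin n → Euc 2), (∀ i, ‖abar i‖ ≤ 1) →
      ∀ (σ : ℝ), 0 < σ →
      ∫⁻ ω, (edgeCount (convexHull ℝ (Set.range ω)) : ℝ≥0∞)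
          ∂(jointGaussian n 2 abar σ)
        ≤ ENNReal.ofReal
            (C * (Real.log n ^ ((1:ℝ)/4) / Real.sqrt σ + Real.sqrt (Real.log n))) := by
  refine ⟨9 + 108 * Real.exp 6, by positivity, fun n hn abar habar σ hσ => ?_⟩
  have hn3 : (3 : ℝ) ≤ n := by exact_mod_cast hn
  have hlog : 1 ≤ Real.log n := by
    rw [Real.le_log_iff_exp_le (by linarith)]
    linarith [Real.exp_one_lt_d9]
  have hL : 1 ≤ Real.sqrt (Real.log n) := Real.one_le_sqrt.mpr hlog
  have hexp : Real.exp (Real.sqrt (Real.log n) ^ 2) = n := by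
    rw [Real.sq_sqrt (by linarith), Real.exp_log (by linarith)]
  refine (lintegral_edgeCount_le habar hσ hL hexp).trans (ENNReal.ofReal_le_ofReal ?_)
  have hroot : Real.sqrt (Real.sqrt (Real.log n) / σ) =
      Real.log n ^ ((1 : ℝ) / 4) / Real.sqrt σ := by
    rw [Real.sqrt_div (Real.sqrt_nonneg _), Real.sqrt_eq_rpow, Real.sqrt_eq_rpow,
      ← Real.rpow_mul (by linarith)]
    norm_num
  rw [hroot]
  have hQ : 0 ≤ Real.log n ^ ((1 : ℝ) / 4) / Real.sqrt σ := by positivity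
  nlinarith [Real.exp_pos 6, mul_le_mul_of_nonneg_left hL (Real.exp_pos 6).le,
    mul_nonneg (Real.exp_pos 6).le hQ]
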